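/- Let i ∈ I. A word w of length m satisfies ε_j(w) ≤ δ_{i,j} for all j ∈ I if and only if w_p = i + (m − p) in I for every 1 ≤ p ≤ m, i.e. w encodes the tensor product b_i ⊗ b_{i+1} ⊗ ⋯ ⊗ b_{i+m−1}. In particular there is exactly one such word. -/

import Mathlib

open Finset Polynomial

namespace GreensteinPaths

noncomputable section

attribute [local instance] Classical.propDecidable

variable {ℓ m : ℕ}

/-- The Kashiwara function `R^i_p(w)` (positions are 0-based: index `p` is
the mathematical position `p+1`, i.e. the `(p+1)`-th tensor factor counted
from the right). -/
def Rf (i : ZMod (ℓ + 1)) (w : Fin m → ZMod (ℓ + 1)) (p : Fin m) : ℤ :=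
    (if i = w p then 1 else 0)
  + ∑ s ∈ univ.filter (fun s : Fin m => p < s),
      ((if i = w s then 1 else 0) - (if i = w s + 1 then 1 else 0))

/-- `ε_i(w) = max_p R^i_p(w)` (the maximum is nonnegative for `m ≥ 1`,
so we may record it as a natural number). -/
def eps (i : ZMod (ℓ + 1)) (w : Fin m → ZMod (ℓ + 1)) : ℕ :=
  univ.sup fun p => (Rf i w p).toNat

/-- `φ_i(w) = ε_i(w) + Σ_s (δ_{i,w_s+1} − δ_{i,w_s})`. -/
def phiW (i : ZMod (ℓ + 1)) (w : Fin m → ZMod (ℓ + 1)) : ℤ :=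
  (eps i w : ℤ)
    + ∑ s : Fin m, ((if i = w s + 1 then 1 else 0) - (if i = w s then 1 else 0))

/-- The Kashiwara operator `e_i`, as a partial map: take the largest `p`
with `R^i_p(w) = ε_i(w)`; if `w_p = i`, replace it by `i - 1`, otherwise
the result is undefined. -/
def eOp (i : ZMod (ℓ + 1)) (w : Fin m → ZMod (ℓ + 1)) :
    Option (Fin m → ZMod (ℓ + 1)) :=
  WithBot.recBotCoe none
    (fun p => if w p = i then some (Function.update w p (i - 1)) else none)
    ((univ.filter fun p => Rf i w p = (eps i w : ℤ)).max)

/-- The Kashiwara operator `f_i`, as a partial map: take the smallest `p`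
with `R^i_p(w) = ε_i(w)`; if `w_p = i - 1`, replace it by `i`, otherwise
the result is undefined. -/
def fOp (i : ZMod (ℓ + 1)) (w : Fin m → ZMod (ℓ + 1)) :
    Option (Fin m → ZMod (ℓ + 1)) :=
  WithTop.recTopCoe none
    (fun p => if w p = i - 1 then some (Function.update w p i) else none)
    ((univ.filter fun p => Rf i w p = (eps i w : ℤ)).min)

/-- The descent set of a word, 0-based: `r ∈ desc w` corresponds to the
mathematical descent `r+1` (i.e. `w_{r+1} > w_{r+2}` in 1-based notation),
letters being compared as integers in `{0,…,ℓ}`. -/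
def desc (w : Fin m → ZMod (ℓ + 1)) : Finset (Fin m) :=
  univ.filter fun r : Fin m =>
    ∃ h : (r : ℕ) + 1 < m, (w ⟨(r : ℕ) + 1, h⟩).val < (w r).val

/-- `N(w) = Σ_{r=1}^{k} r (n_r − n_{r−1})` where `0 = n_0 < n_1 < ⋯ < n_{k−1} < n_k = m`
and `n_1 < ⋯ < n_{k−1}` are the descents: equivalently the mathematical
position `p` (`1 ≤ p ≤ m`) contributes `1` plus the number of descents
strictly below `p`. -/
def Nfun (w : Fin m → ZMod (ℓ + 1)) : ℕ :=
  ∑ p : Fin m, (1 + ((desc w).filter fun r => r < p).card)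

/-- The major index: the sum of the descents (which are `r+1` for the
0-based `r ∈ desc w`). -/
def MajFun (w : Fin m → ZMod (ℓ + 1)) : ℕ :=
  ∑ r ∈ desc w, ((r : ℕ) + 1)

/-- Content of a word: `content w j` is the number of positions carrying the letter `j`. -/
def content (w : Fin m → ZMod (ℓ + 1)) (j : ZMod (ℓ + 1)) : ℕ :=
  (univ.filter fun p => w p = j).card

/-- The affine operator `ê_i` on pairs `(w, c)`. -/
def eHat (i : ZMod (ℓ + 1)) (x : (Fin m → ZMod (ℓ + 1)) × ℤ) :
    Option ((Fin m → ZMod (ℓ + 1)) × ℤ) :=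
  (eOp i x.1).map fun w' => (w', x.2 + if i = 0 then 1 else 0)

/-- The affine operator `f̂_i` on pairs `(w, c)`. -/
def fHat (i : ZMod (ℓ + 1)) (x : (Fin m → ZMod (ℓ + 1)) × ℤ) :
    Option ((Fin m → ZMod (ℓ + 1)) × ℤ) :=
  (fOp i x.1).map fun w' => (w', x.2 - if i = 0 then 1 else 0)

/-- One application of some `ê_i` or `f̂_i`. -/
def hatStep (x y : (Fin m → ZMod (ℓ + 1)) × ℤ) : Prop :=
  ∃ i, eHat i x = some y ∨ fHat i x = some y

/-- `Ô_n`: all pairs obtainable from `((0,…,0), n)` by finitely many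
applications of the operators `ê_i`, `f̂_i`. -/
def Ohat (n : ℤ) : Set ((Fin m → ZMod (ℓ + 1)) × ℤ) :=
  {x | Relation.ReflTransGen hatStep ((fun _ => 0), n) x}

/-- Successive application of a partial operator along a list of indices
(the head of the list is applied first); the result is defined only if
every intermediate application is defined. -/
def applyList
    (op : ZMod (ℓ + 1) → (Fin m → ZMod (ℓ + 1)) → Option (Fin m → ZMod (ℓ + 1))) :
    List (ZMod (ℓ + 1)) → (Fin m → ZMod (ℓ + 1)) → Option (Fin m → ZMod (ℓ + 1))
  | [], w => some w
  | i :: is, w => (op i w).bind (applyList op is)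

/-- `n`-fold application of `e_i`. -/
def eIter (i : ZMod (ℓ + 1)) : ℕ → (Fin m → ZMod (ℓ + 1)) → Option (Fin m → ZMod (ℓ + 1))
  | 0, w => some w
  | n + 1, w => (eOp i w).bind (eIter i n)

/-- `φ_n(d) = φ(d)·μ(d/g)/φ(d/g)`, `g = gcd(d,|n|)`. -/
def phiInt (n : ℤ) (d : ℕ) : ℚ :=
  (Nat.totient d : ℚ) * (ArithmeticFunction.moebius (d / Nat.gcd d n.natAbs) : ℚ)
    / (Nat.totient (d / Nat.gcd d n.natAbs) : ℚ)

/-- The multinomial coefficient `(m/d)! / ((k_0/d)! ⋯ (k_ℓ/d)!)`, with the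
convention that it is `0` unless all its entries are (nonnegative) integers. -/
def multinomialQ {ι : Type} [Fintype ι] (M : ℕ) (k : ι → ℕ) (d : ℕ) : ℚ :=
  if d ∣ M ∧ ∀ j, d ∣ k j then
    ((M / d).factorial : ℚ) / ∏ j, ((k j / d).factorial : ℚ)
  else 0

/-- `C(k_0,…,k_ℓ; n) = (1/m) Σ_{d ∣ m} φ_n(d) · multinomial(m/d; k_j/d)`. -/
def Cfun {ι : Type} [Fintype ι] (M : ℕ) (k : ι → ℕ) (n : ℤ) : ℚ :=
  (1 / (M : ℚ)) * ∑ d ∈ M.divisors, phiInt n d * multinomialQ M k d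

/-- `C̃(k_0,…,k_ℓ; d) = (d/m) Σ_{d d' ∣ m} μ(d') · multinomial(m/(dd'); k_j/(dd'))`. -/
def Ctil {ι : Type} [Fintype ι] (M : ℕ) (k : ι → ℕ) (d : ℕ) : ℚ :=
  ((d : ℚ) / (M : ℚ)) *
    ∑ d' ∈ M.divisors.filter (fun d' => d * d' ∣ M),
      (ArithmeticFunction.moebius d' : ℚ) * multinomialQ M k (d * d')

/-- `[n]_q = 1 + q + ⋯ + q^{n−1}` in `ℤ[q]`. -/
def qNat (n : ℕ) : Polynomial ℤ := ∑ i ∈ Finset.range n, X ^ i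

/-- `[n]_q! = [n]_q [n−1]_q ⋯ [1]_q`. -/
def qFactorial (n : ℕ) : Polynomial ℤ := ∏ i ∈ Finset.range n, qNat (i + 1)

/-- The Gaussian multinomial `[n; k_1,…,k_r]_q = [n]_q!/([k_1]_q! ⋯ [k_r]_q!)`
(an exact division of polynomials, performed here as division by a monic
polynomial), with the convention that it is `0` if `n ≠ k_1 + ⋯ + k_r`. -/
def qMultinomial {ι : Type} [Fintype ι] (n : ℕ) (k : ι → ℕ) : Polynomial ℤ :=
  if ∑ j, k j = n then qFactorial n /ₘ ∏ j, qFactorial (k j) else 0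

end

theorem sum_gt_telescope {m : ℕ} (p : Fin m) (f : ℕ → ℤ) :
    ∑ s ∈ univ.filter (fun s : Fin m => p < s), (f (m - 1 - s) - f (m - 1 - s + 1)) =
      f 0 - f (m - 1 - p) := by
  rw [← Finset.sum_range_sub']
  refine Finset.sum_nbij (fun s : Fin m => m - 1 - (s : ℕ)) ?_ ?_ ?_ ?_
  · intro s hs
    simp only [mem_filter, mem_univ, true_and, Fin.lt_def, mem_range] at hs ⊢
    omega
  · intro s _ t _ h
    ext
    dsimp only at h
    omega
  · intro k hk
    simp only [coe_range, Set.mem_Iio] at hk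
    refine ⟨⟨m - 1 - k, by omega⟩, ?_, ?_⟩
    · simp only [coe_filter, mem_univ, true_and, Set.mem_ofPred_eq, Fin.lt_def]
      omega
    · dsimp only
      omega
  · intro s _
    rfl

/-- If all letters to the left of position `p` follow the pattern `i, i + 1, …`, then
`R^j_p(w)` compares `w p` with the letter that continues the pattern. -/
theorem Rf_of_forall_gt {ℓ m : ℕ} (i j : ZMod (ℓ + 1)) (w : Fin m → ZMod (ℓ + 1)) (p : Fin m)
    (h : ∀ s : Fin m, p < s → w s = i + ((m - 1 - (s : ℕ) : ℕ) : ZMod (ℓ + 1))) :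
    Rf j w p = (if j = w p then 1 else 0) + (if i = j then 1 else 0)
      - (if j = i + ((m - 1 - (p : ℕ) : ℕ) : ZMod (ℓ + 1)) then 1 else 0) := by
  have key := sum_gt_telescope p
    (fun k : ℕ => if j = i + (k : ZMod (ℓ + 1)) then (1 : ℤ) else 0)
  simp only [Nat.cast_zero, add_zero, Nat.cast_add, Nat.cast_one, ← add_assoc] at key
  rw [Rf, Finset.sum_congr rfl (g := fun s : Fin m =>
    (if j = i + ((m - 1 - (s : ℕ) : ℕ) : ZMod (ℓ + 1)) then (1 : ℤ) else 0)
      - if j = i + ((m - 1 - (s : ℕ) : ℕ) : ZMod (ℓ + 1)) + 1 then 1 else 0), key,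
    ← add_sub_assoc]
  · simp only [eq_comm]
  · intro s hs
    simp only [h s (mem_filter.mp hs).2]

theorem Rf_le_eps {ℓ m : ℕ} (i : ZMod (ℓ + 1)) (w : Fin m → ZMod (ℓ + 1)) (p : Fin m) :
    Rf i w p ≤ eps i w :=
  (Int.self_le_toNat _).trans <| Int.ofNat_le.mpr <|
    Finset.le_sup (f := fun p => (Rf i w p).toNat) (mem_univ p)

theorem forall_eps_le_iff {ℓ m : ℕ} (i : ZMod (ℓ + 1)) (w : Fin m → ZMod (ℓ + 1)) :
    (∀ j : ZMod (ℓ + 1), eps j w ≤ if i = j then 1 else 0) ↔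
      ∀ p : Fin m, w p = i + ((m - 1 - (p : ℕ) : ℕ) : ZMod (ℓ + 1)) := by
  constructor
  · intro h p
    induction p using WellFoundedGT.induction with
    | ind p ih =>
      have hR := Rf_of_forall_gt i (w p) w p ih
      have hle := (Rf_le_eps (w p) w p).trans (Int.ofNat_le.mpr (h (w p)))
      by_contra hne
      rw [hR, if_pos rfl, if_neg hne] at hle
      split_ifs at hle <;> simp at hle
  · intro h j
    refine Finset.sup_le fun p _ => ?_
    rw [Rf_of_forall_gt i j w p fun s _ => h s, h p]
    split_ifs <;> simp

/-- a word `w` of length `m` satisfies `ε_j(w) ≤ δ_{i,j}` for all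
`j ∈ I` iff `w_p = i + (m − p)` in `I` for every `1 ≤ p ≤ m` (0-based:
`w p = i + (m − 1 − p)`), i.e. `w` encodes `b_i ⊗ b_{i+1} ⊗ ⋯ ⊗ b_{i+m−1}`;
in particular there is exactly one such word. -/
theorem stmt_9 (ℓ m : ℕ) (hℓ : 1 ≤ ℓ) (hm : 1 ≤ m) (i : ZMod (ℓ + 1)) :
    (∀ w : Fin m → ZMod (ℓ + 1),
      (∀ j : ZMod (ℓ + 1), eps j w ≤ if i = j then 1 else 0) ↔
        (∀ p : Fin m, w p = i + ((m - 1 - (p : ℕ) : ℕ) : ZMod (ℓ + 1)))) ∧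
    (∃! w : Fin m → ZMod (ℓ + 1),
      ∀ j : ZMod (ℓ + 1), eps j w ≤ if i = j then 1 else 0) := by
  simp only [forall_eps_le_iff, implies_true, true_and]
  exact ⟨_, fun _ => rfl, fun w hw => funext hw⟩

end GreensteinPaths
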